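/- If some α ∈ Δ₀ satisfies α^ω = 0, then the action of ⟨ω⟩ on Δ₀ is transitive. Equivalently: if ⟨ω⟩ does not act transitively on Δ₀, then α^ω ≠ 0 for every α ∈ Δ₀, so {α^ω : α ∈ Δ₀} ⊆ Φ_re^ω. -/

import Mathlib

open scoped RealInnerProductSpace

namespace Folding

variable {E : Type*} [NormedAddCommGroup E] [InnerProductSpace ℝ E]

/-- The coroot `α^∨ = 2α/(α,α)` of a nonzero vector `α`. -/
noncomputable def coroot (α : E) : E := (2 / ⟪α, α⟫) • α

/-- The reflection `s_α(x) = x - (α^∨, x) α`. -/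
noncomputable def reflVec (α x : E) : E := x - ⟪coroot α, x⟫ • α

/-- `Φ` is a (finite, not necessarily reduced) root system in `E`. -/
def IsRootSystem (Φ : Set E) : Prop :=
  Φ.Finite ∧ (0 : E) ∉ Φ ∧ Submodule.span ℝ Φ = ⊤ ∧
    (∀ α ∈ Φ, ∀ β ∈ Φ, reflVec α β ∈ Φ) ∧
    ∀ α ∈ Φ, ∀ β ∈ Φ, ∃ n : ℤ, ⟪coroot α, β⟫ = (n : ℝ)

/-- `Φ` is reduced: no root is half of another root. -/
def IsReducedRS (Φ : Set E) : Prop := ∀ α ∈ Φ, (2⁻¹ : ℝ) • α ∉ Φ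

/-- `Φ` is irreducible: nonempty and not a disjoint union of two nonempty
mutually orthogonal subsets. -/
def IsIrreducibleRS (Φ : Set E) : Prop :=
  Φ.Nonempty ∧
    ¬∃ Φ₁ Φ₂ : Set E, Φ₁.Nonempty ∧ Φ₂.Nonempty ∧ Φ₁ ∪ Φ₂ = Φ ∧ Disjoint Φ₁ Φ₂ ∧
      ∀ u ∈ Φ₁, ∀ v ∈ Φ₂, ⟪u, v⟫ = 0

/-- `Δ` is a basis (a set of simple roots) of the root system `Φ`:
it is a vector space basis of `E`, and every root is a linear combination of `Δ`
whose coefficients are all nonnegative integers or all nonpositive integers. -/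
def IsBaseRS (Φ : Set E) (Δ : Finset E) : Prop :=
  ↑Δ ⊆ Φ ∧ LinearIndependent ℝ (fun α : {x : E // x ∈ Δ} => (α : E)) ∧
    Submodule.span ℝ (Δ : Set E) = ⊤ ∧
    ∀ β ∈ Φ, ∃ c : E → ℤ, ((∀ α, 0 ≤ c α) ∨ (∀ α, c α ≤ 0)) ∧
      β = ∑ α ∈ Δ, (c α : ℝ) • α

/-- `ω` belongs to the Weyl group of `Φ`: it is a product of reflections in roots. -/
def InWeylGroup (Φ : Set E) (ω : E ≃ₗᵢ[ℝ] E) : Prop :=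
  ∃ l : List E, (∀ α ∈ l, α ∈ Φ) ∧ ∀ x : E, ω x = l.foldr reflVec x

/-- The average `x^ω = (1/o(ω)) Σ_{t=1}^{o(ω)} ω^t(x)`, where `o(ω)` is the order of `ω`. -/
noncomputable def avg (ω : E ≃ₗᵢ[ℝ] E) (x : E) : E :=
  (orderOf ω : ℝ)⁻¹ • ∑ t ∈ Finset.range (orderOf ω), (ω ^ (t + 1)) x

/-- The fixed-point set `E^ω`. -/
def fixedSet (ω : E ≃ₗᵢ[ℝ] E) : Set E := {x | ω x = x}

/-- The fixed-point subspace `E^ω`. -/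
def fixedSubmodule (ω : E ≃ₗᵢ[ℝ] E) : Submodule ℝ E :=
  LinearMap.ker ((ω.toLinearEquiv : E →ₗ[ℝ] E) - LinearMap.id)

/-- The folded root system `Φ_re^ω = {β^ω : β ∈ Φ, β^ω ≠ 0}`. -/
noncomputable def foldedRoots (Φ : Set E) (ω : E ≃ₗᵢ[ℝ] E) : Set E :=
  {v | v ≠ 0 ∧ ∃ β ∈ Φ, avg ω β = v}

/-- The `⟨ω⟩`-orbit `O(β) = {ω^t(β) : t ∈ ℤ}`. -/
def orbitOf (ω : E ≃ₗᵢ[ℝ] E) (β : E) : Set E := {γ | ∃ t : ℤ, (ω ^ t) β = γ}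

/-- `N(β) = {γ ∈ O(β) : γ ≠ ±β, (β,γ) ≠ 0}`. -/
def nbrOf (ω : E ≃ₗᵢ[ℝ] E) (β : E) : Set E :=
  {γ | γ ∈ orbitOf ω β ∧ γ ≠ β ∧ γ ≠ -β ∧ ⟪β, γ⟫ ≠ 0}


/-- `Δ^ω`: the averages of the simple roots whose `⟨ω⟩`-orbit avoids `α₀ = -htilde`. -/
noncomputable def simpleAvg (Δ : Finset E) (htilde : E) (ω : E ≃ₗᵢ[ℝ] E) : Set E :=
  {v | ∃ α ∈ (Δ : Set E), -htilde ∉ orbitOf ω α ∧ avg ω α = v}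

/-- `π̄_S = (Σ_{α ∈ S} ϖ_α^∨)^ω` for a subset `S` of `Δ₀`. -/
noncomputable def pibar (ω : E ≃ₗᵢ[ℝ] E) (ϖ : E → E) (S : Set E) : E :=
  avg ω (∑ᶠ γ ∈ S, ϖ γ)

end Folding

namespace Folding

section Basis

variable {E : Type*} [NormedAddCommGroup E] [InnerProductSpace ℝ E]

theorem inner_coroot (α x : E) : ⟪coroot α, x⟫ = 2 / ⟪α, α⟫ * ⟪α, x⟫ := by
  rw [coroot, real_inner_smul_left]

theorem inner_reflVec {α : E} (hα : α ≠ 0) (x : E) : ⟪α, reflVec α x⟫ = -⟪α, x⟫ := by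
  have h : ⟪α, α⟫ ≠ 0 := inner_self_ne_zero.2 hα
  rw [reflVec, inner_sub_right, real_inner_smul_right, inner_coroot]
  field_simp
  ring

theorem IsRootSystem.neg_mem {Φ : Set E} (hΦ : IsRootSystem Φ) {β : E} (hβ : β ∈ Φ) :
    -β ∈ Φ := by
  have hβ0 : β ≠ 0 := fun h => hΦ.2.1 (h ▸ hβ)
  have h : ⟪β, β⟫ ≠ 0 := inner_self_ne_zero.2 hβ0
  have hs := hΦ.2.2.2.1 β hβ β hβ
  rwa [reflVec, inner_coroot, div_mul_cancel₀ _ h, two_smul, sub_add_cancel_left] at hs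

variable {ι : Type*} (b : Module.Basis ι ℝ E)

theorem repr_reflVec_of_ne {i j : ι} (h : j ≠ i) (x : E) :
    b.repr (reflVec (b i) x) j = b.repr x j := by
  simp [reflVec, Finsupp.single_eq_of_ne h]

theorem repr_reflVec_self (i : ι) (x : E) :
    b.repr (reflVec (b i) x) i = b.repr x i - ⟪coroot (b i), x⟫ := by
  simp [reflVec]

theorem inner_coroot_pos {α x : E} (h : 0 < ⟪α, x⟫) : 0 < ⟪coroot α, x⟫ := by
  have hα : α ≠ 0 := by rintro rfl; simp at h
  have : 0 < ⟪α, α⟫ := real_inner_self_pos.2 hα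
  rw [inner_coroot]
  positivity

theorem sum_repr_reflVec [Fintype ι] (i : ι) (x : E) :
    ∑ j, b.repr (reflVec (b i) x) j = ∑ j, b.repr x j - ⟪coroot (b i), x⟫ := by
  classical
  rw [← Finset.add_sum_erase _ _ (Finset.mem_univ i),
    ← Finset.add_sum_erase _ (fun j => b.repr x j) (Finset.mem_univ i), repr_reflVec_self,
    Finset.sum_congr rfl fun j hj => repr_reflVec_of_ne b (Finset.ne_of_mem_erase hj) x]
  ring

variable {Φ : Set E} (hΦ : IsRootSystem Φ) (hb : ∀ i, b i ∈ Φ)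
  (hsign : ∀ β ∈ Φ, (∀ i, 0 ≤ b.repr β i) ∨ ∀ i, b.repr β i ≤ 0)

include hΦ hb hsign

/-- Distinct simple roots form a non-acute angle. -/
theorem inner_simple_nonpos {i j : ι} (hij : i ≠ j) : ⟪b i, b j⟫ ≤ 0 := by
  by_contra! h
  have hpos := inner_coroot_pos h
  have hi := repr_reflVec_self b i (b j)
  have hj := repr_reflVec_of_ne b hij.symm (b j)
  simp only [Module.Basis.repr_self, Finsupp.single_eq_same, Finsupp.single_eq_of_ne hij,
    zero_sub] at hi hj
  rcases hsign _ (hΦ.2.2.2.1 _ (hb i) _ (hb j)) with h' | h'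
  · linarith [h' i]
  · linarith [h' j]

/-- If the simple roots split into two orthogonal parts, then the support of a positive root
does not meet both parts. -/
theorem not_mixed_of_nonneg [Fintype ι] {P : ι → Prop}
    (hP : ∀ i j, P i → ¬P j → ⟪b i, b j⟫ = 0) {β : E} (hβ : β ∈ Φ)
    (hβ0 : ∀ i, 0 ≤ b.repr β i) {i j : ι} (hi : P i) (hβi : b.repr β i ≠ 0) (hj : ¬P j) :
    b.repr β j = 0 := by
  classical
  by_contra hβj
  set M : Set E := {β ∈ Φ | (∀ i, 0 ≤ b.repr β i) ∧ (∃ i, P i ∧ b.repr β i ≠ 0) ∧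
    ∃ j, ¬P j ∧ b.repr β j ≠ 0}
  obtain ⟨γ, ⟨hγ, hγ0, ⟨i, hi, hγi⟩, j, hj, hγj⟩, hmin⟩ :=
    Set.exists_min_image M (fun x => ∑ j, b.repr x j) (hΦ.1.subset fun x hx => hx.1)
      ⟨β, hβ, hβ0, ⟨i, hi, hβi⟩, j, hj, hβj⟩
  set u := ∑ k with P k, b.repr γ k • b k with hu
  set v := ∑ k with ¬P k, b.repr γ k • b k with hv
  have huv : u + v = γ := by
    rw [hu, hv, Finset.sum_filter_add_sum_filter_not, b.sum_repr]
  have hv0 : ∀ x : E, (∀ k, P k → b.repr x k = 0) → ∀ k, P k → ⟪b k, x⟫ = 0 := by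
    intro x hx k hk
    rw [← b.sum_repr x, inner_sum]
    refine Finset.sum_eq_zero fun l _ => ?_
    rw [real_inner_smul_right]
    by_cases hl : P l
    · rw [hx l hl, zero_mul]
    · rw [hP k l hk hl, mul_zero]
  have huv0 : ⟪u, v⟫ = 0 := by
    rw [hu, hv, sum_inner]
    refine Finset.sum_eq_zero fun k hk => ?_
    rw [inner_sum]
    refine Finset.sum_eq_zero fun l hl => ?_
    rw [real_inner_smul_left, real_inner_smul_right,
      hP k l (Finset.mem_filter.1 hk).2 (Finset.mem_filter.1 hl).2]
    simp
  have hu0 : u ≠ 0 := by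
    intro h
    apply hγi
    have := congrArg (fun x => b.repr x i) h
    simpa [hu, Finsupp.single_apply, Finset.sum_ite_eq, hi] using this
  have hpos : 0 < ⟪u, γ⟫ := by
    rw [← huv, inner_add_right, huv0, add_zero]
    exact real_inner_self_pos.2 hu0
  rw [hu, sum_inner] at hpos
  obtain ⟨a, ha, hapos⟩ := Finset.exists_lt_of_sum_lt
    (by simpa using hpos : ∑ k with P k, (0 : ℝ) < ∑ k with P k, ⟪b.repr γ k • b k, γ⟫)
  replace ha := (Finset.mem_filter.1 ha).2
  rw [real_inner_smul_left] at hapos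
  have haγ : 0 < ⟪b a, γ⟫ := pos_of_mul_pos_right hapos (hγ0 a)
  have hsΦ := hΦ.2.2.2.1 _ (hb a) _ hγ
  have hsj : b.repr (reflVec (b a) γ) j = b.repr γ j :=
    repr_reflVec_of_ne b (by rintro rfl; exact hj ha) γ
  have hs0 : ∀ i, 0 ≤ b.repr (reflVec (b a) γ) i :=
    (hsign _ hsΦ).resolve_right fun h => hγj (le_antisymm (hsj ▸ h j) (hγ0 j))
  have hsP : ∃ i, P i ∧ b.repr (reflVec (b a) γ) i ≠ 0 := by
    by_contra! h
    have h1 := hv0 _ h a ha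
    rw [inner_reflVec (b.ne_zero a)] at h1
    linarith
  have := hmin _ ⟨hsΦ, hs0, hsP, j, hj, hsj ▸ hγj⟩
  rw [sum_repr_reflVec] at this
  linarith [inner_coroot_pos haγ]

/-- The simple roots of an irreducible root system do not split into two nonempty
orthogonal parts. -/
theorem not_simple_split [Fintype ι] (hirr : IsIrreducibleRS Φ) {P : ι → Prop}
    (hP : ∀ i j, P i → ¬P j → ⟪b i, b j⟫ = 0) {i j : ι} (hi : P i) : P j := by
  classical
  by_contra hj
  have hmix : ∀ β ∈ Φ, ∀ i j, P i → b.repr β i ≠ 0 → ¬P j → b.repr β j = 0 := by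
    intro β hβ i j hi hβi hj
    rcases hsign β hβ with h | h
    · exact not_mixed_of_nonneg b hΦ hb hsign hP hβ h hi hβi hj
    · have := not_mixed_of_nonneg b hΦ hb hsign hP (hΦ.neg_mem hβ) (by simpa using h) hi
        (by simpa using hβi) hj
      simpa using this
  refine hirr.2 ⟨{β ∈ Φ | ∀ j, ¬P j → b.repr β j = 0}, {β ∈ Φ | ∀ i, P i → b.repr β i = 0},
    ⟨b i, hb i, ?_⟩, ⟨b j, hb j, ?_⟩, ?_, ?_, ?_⟩
  · intro k hk
    rw [b.repr_self, Finsupp.single_eq_of_ne (by rintro rfl; exact hk hi)]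
  · intro k hk
    rw [b.repr_self, Finsupp.single_eq_of_ne (by rintro rfl; exact hj hk)]
  · ext β
    constructor
    · rintro (h | h) <;> exact h.1
    · intro hβ
      by_cases h : ∀ i, P i → b.repr β i = 0
      · exact Or.inr ⟨hβ, h⟩
      · push Not at h
        obtain ⟨i, hi, hβi⟩ := h
        exact Or.inl ⟨hβ, fun j hj => hmix β hβ i j hi hβi hj⟩
  · rw [Set.disjoint_left]
    rintro β ⟨hβ, h1⟩ ⟨-, h2⟩
    refine hΦ.2.1 ((b.ext_elem fun k => ?_ : β = 0) ▸ hβ)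
    by_cases hk : P k
    · simp [h2 k hk]
    · simp [h1 k hk]
  · rintro u ⟨-, hu⟩ v ⟨-, hv⟩
    rw [← b.sum_repr u, ← b.sum_repr v, sum_inner]
    refine Finset.sum_eq_zero fun k _ => ?_
    rw [inner_sum]
    refine Finset.sum_eq_zero fun l _ => ?_
    rw [real_inner_smul_left, real_inner_smul_right]
    by_cases hk : P k
    · by_cases hl : P l
      · simp [hv l hl]
      · simp [hP k l hk hl]
    · simp [hu k hk]

/-- Every coefficient of a root of maximal height in an irreducible root system is positive. -/
theorem repr_highest_pos [Fintype ι] (hirr : IsIrreducibleRS Φ) {θ : E} (hθ : θ ∈ Φ)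
    (hmax : ∀ β ∈ Φ, ∑ i, b.repr β i ≤ ∑ i, b.repr θ i) (j : ι) : 0 < b.repr θ j := by
  have hθ0 : θ ≠ 0 := fun h => hΦ.2.1 (h ▸ hθ)
  have hneg := hmax _ (hΦ.neg_mem hθ)
  simp only [map_neg, Finsupp.neg_apply, Finset.sum_neg_distrib] at hneg
  have hnonneg : ∀ i, 0 ≤ b.repr θ i := by
    refine (hsign θ hθ).resolve_right fun h => hθ0 (b.ext_elem fun k => ?_)
    have h0 : ∑ i, b.repr θ i = 0 :=
      le_antisymm (Finset.sum_nonpos fun i _ => h i) (by linarith)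
    simpa using (Finset.sum_eq_zero_iff_of_nonpos fun i _ => h i).1 h0 k (Finset.mem_univ k)
  obtain ⟨i, hi⟩ : ∃ i, b.repr θ i ≠ 0 := by
    by_contra! h
    exact hθ0 (b.ext_elem fun k => by simpa using h k)
  have hdom : ∀ i, 0 ≤ ⟪b i, θ⟫ := by
    intro i
    by_contra! h
    have h1 := hmax _ (hΦ.2.2.2.1 _ (hb i) _ hθ)
    rw [sum_repr_reflVec] at h1
    have h2 : 0 < ⟪coroot (b i), -θ⟫ := inner_coroot_pos (by rw [inner_neg_right]; linarith)
    rw [inner_neg_right] at h2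
    linarith
  refine (hnonneg j).lt_of_ne' (not_simple_split b hΦ hb hsign hirr
    (P := fun k => b.repr θ k ≠ 0) (fun k l hk hl => ?_) hi)
  have hl0 : b.repr θ l = 0 := not_not.1 hl
  have hterm : ∀ m ∈ Finset.univ, b.repr θ m * ⟪b l, b m⟫ ≤ 0 := by
    intro m _
    by_cases hm : l = m
    · rw [← hm, hl0, zero_mul]
    · exact mul_nonpos_of_nonneg_of_nonpos (hnonneg m) (inner_simple_nonpos b hΦ hb hsign hm)
  have hsum : ⟪b l, θ⟫ = ∑ m, b.repr θ m * ⟪b l, b m⟫ := by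
    conv_lhs => rw [← b.sum_repr θ, inner_sum]
    simp only [real_inner_smul_right]
  have hzero : ∑ m, b.repr θ m * ⟪b l, b m⟫ = 0 :=
    le_antisymm (Finset.sum_nonpos hterm) (hsum ▸ hdom l)
  have := (Finset.sum_eq_zero_iff_of_nonpos hterm).1 hzero k (Finset.mem_univ k)
  rw [real_inner_comm]
  exact (mul_eq_zero.1 this).resolve_left hk

end Basis

section Isometry

variable {E : Type*} [NormedAddCommGroup E] [InnerProductSpace ℝ E]

theorem pow_apply_mem {ω : E ≃ₗᵢ[ℝ] E} {S : Set E} (hω : Set.MapsTo ω S S) (n : ℕ) :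
    Set.MapsTo (ω ^ n : E ≃ₗᵢ[ℝ] E) S S := by
  induction n with
  | zero => intro x hx; simpa using hx
  | succ n ih => intro x hx; rw [pow_succ]; exact ih (hω hx)

/-- A linear isometry preserving a finite spanning set has finite order. -/
theorem isOfFinOrder_of_mapsTo {ω : E ≃ₗᵢ[ℝ] E} {S : Set E} (hS : S.Finite)
    (hspan : Submodule.span ℝ S = ⊤) (hω : Set.MapsTo ω S S) : IsOfFinOrder ω := by
  have := hS.to_subtype
  obtain ⟨m, n, hmn, h⟩ := Finite.exists_ne_map_eq_of_infinite
    (fun n : ℕ => (pow_apply_mem hω n).restrict)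
  have hpow : ω ^ m = ω ^ n := by
    ext x
    refine LinearMap.congr_fun (f := ((ω ^ m : E ≃ₗᵢ[ℝ] E).toLinearEquiv : E →ₗ[ℝ] E))
      (g := ((ω ^ n : E ≃ₗᵢ[ℝ] E).toLinearEquiv : E →ₗ[ℝ] E))
      (LinearMap.ext_on hspan fun y hy => ?_) x
    exact congrArg Subtype.val (congrFun h ⟨y, hy⟩)
  by_contra hinf
  exact hmn (injective_pow_iff_not_isOfFinOrder.2 hinf hpow)

/-- If the average of `α` vanishes, no linear functional is positive on the whole orbit. -/
theorem avg_ne_zero_of_pos {ω : E ≃ₗᵢ[ℝ] E} (hω : IsOfFinOrder ω) {α : E} (f : E →ₗ[ℝ] ℝ)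
    (hf : ∀ γ ∈ orbitOf ω α, 0 < f γ) : avg ω α ≠ 0 := by
  intro h
  have hpos := hω.orderOf_pos
  rw [avg, smul_eq_zero_iff_right (by positivity)] at h
  have h0 := congrArg f h
  rw [map_sum, map_zero] at h0
  have : 0 < ∑ t ∈ Finset.range (orderOf ω), f ((ω ^ (t + 1)) α) :=
    Finset.sum_pos (fun t _ => hf _ ⟨(t + 1 : ℕ), by rw [zpow_natCast]⟩) ⟨0, by simpa using hpos⟩
  exact this.ne' h0

theorem orbitOf_subset {ω : E ≃ₗᵢ[ℝ] E} (hω : IsOfFinOrder ω) {S : Set E}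
    (hS : Set.MapsTo ω S S) {α : E} (hα : α ∈ S) : orbitOf ω α ⊆ S := by
  rintro _ ⟨t, rfl⟩
  obtain ⟨n, hn⟩ := hω.mem_powers_iff_mem_zpowers.2 ⟨t, rfl⟩
  have : ω ^ t = ω ^ n := hn.symm
  rw [this]
  exact pow_apply_mem hS n hα

theorem mem_orbitOf_of_mem {ω : E ≃ₗᵢ[ℝ] E} {α β γ : E} (hβ : β ∈ orbitOf ω α)
    (hγ : γ ∈ orbitOf ω α) : γ ∈ orbitOf ω β := by
  obtain ⟨s, rfl⟩ := hβ
  obtain ⟨t, rfl⟩ := hγ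
  refine ⟨t - s, ?_⟩
  change (ω ^ (t - s) * ω ^ s) α = (ω ^ t) α
  rw [← zpow_add, sub_add_cancel]

/-- If all coordinates of `θ` are positive, then deleting any one vector from the basis
extended by `-θ` leaves a set on which some linear functional is positive. -/
theorem exists_functional_pos {ι : Type*} [Fintype ι] (b : Module.Basis ι ℝ E) {θ : E}
    (hθ : ∀ i, 0 < b.repr θ i) {β : E} (hβ : β ∈ Set.range b ∪ {-θ}) :
    ∃ f : E →ₗ[ℝ] ℝ, ∀ γ ∈ Set.range b ∪ {-θ}, γ ≠ β → 0 < f γ := by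
  have hH : ∀ x, (∑ j, b.coord j) x = ∑ j, b.repr x j := fun x => by simp
  have hHb : ∀ k, (∑ j, b.coord j) (b k) = 1 := fun k => by
    classical simp [Finsupp.single_apply]
  rcases hβ with ⟨i, rfl⟩ | hβ
  · refine ⟨∑ j, b.coord j - ((∑ j, b.repr θ j + 1) / b.repr θ i) • b.coord i, ?_⟩
    rintro γ (⟨k, rfl⟩ | rfl) hγ
    · have hki : i ≠ k := by rintro rfl; exact hγ rfl
      rw [LinearMap.sub_apply, hHb, LinearMap.smul_apply, b.coord_apply, b.repr_self,
        Finsupp.single_eq_of_ne hki]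
      simp
    · rw [map_neg, LinearMap.sub_apply, hH, LinearMap.smul_apply, b.coord_apply, smul_eq_mul,
        div_mul_cancel₀ _ (hθ i).ne']
      simp
  · refine ⟨∑ j, b.coord j, ?_⟩
    rintro γ (⟨k, rfl⟩ | rfl) hγ
    · rw [hHb]
      exact one_pos
    · exact absurd hβ.symm hγ

end Isometry

end Folding

open Folding

theorem simple_avg_zero_implies_transitive
    {E : Type*} [NormedAddCommGroup E] [InnerProductSpace ℝ E] [FiniteDimensional ℝ E]
    (Φ : Set E) (Δ : Finset E) (coeff : E → E → ℝ) (htilde : E) (ω : E ≃ₗᵢ[ℝ] E)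
    (hΦrs : IsRootSystem Φ) (hΦred : IsReducedRS Φ) (hΦirr : IsIrreducibleRS Φ)
    (hΔ : IsBaseRS Φ Δ)
    (hcoeff : ∀ β ∈ Φ, β = ∑ α ∈ Δ, coeff β α • α)
    (hht : htilde ∈ Φ)
    (hhighest : ∀ β ∈ Φ, β ≠ htilde → ∑ α ∈ Δ, coeff β α < ∑ α ∈ Δ, coeff htilde α)
    (hωW : InWeylGroup Φ ω)
    (hωΔ₀ : ⇑ω '' (↑Δ ∪ {-htilde}) = ↑Δ ∪ {-htilde})
    (h0 : ∃ α ∈ (↑Δ ∪ {-htilde} : Set E), avg ω α = 0) :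
    ∀ α ∈ (↑Δ ∪ {-htilde} : Set E), ∀ β ∈ (↑Δ ∪ {-htilde} : Set E),
      β ∈ orbitOf ω α := by
  obtain ⟨hΔΦ, hli, hspan, hint⟩ := hΔ
  let b : Module.Basis {x : E // x ∈ Δ} ℝ E := Module.Basis.mk hli (by
    rw [Subtype.range_coe_subtype]; exact hspan.ge)
  have hbv : ∀ i, b i = i := fun i => Module.Basis.mk_apply _ _ i
  have hbΦ : ∀ i, b i ∈ Φ := fun i => hbv i ▸ hΔΦ i.2
  have hrepr : ∀ c : E → ℝ, ∀ i, b.repr (∑ α ∈ Δ, c α • α) i = c i := by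
    intro c i
    have h : ∑ α ∈ Δ, c α • α = ∑ j : {x : E // x ∈ Δ}, c j • b j := by
      simp only [hbv]
      exact (Finset.sum_coe_sort Δ fun α => c α • α).symm
    rw [h, b.repr_sum_self]
  have hsign : ∀ β ∈ Φ, (∀ i, 0 ≤ b.repr β i) ∨ ∀ i, b.repr β i ≤ 0 := by
    intro β hβ
    obtain ⟨c, hc, h⟩ := hint β hβ
    rw [h]
    simp only [hrepr fun α => (c α : ℝ)]
    exact hc.imp (fun h i => by exact_mod_cast h i) fun h i => by exact_mod_cast h i
  have hheight : ∀ β ∈ Φ, ∑ i, b.repr β i = ∑ α ∈ Δ, coeff β α := by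
    intro β hβ
    rw [← Finset.sum_coe_sort Δ]
    refine Finset.sum_congr rfl fun i _ => ?_
    conv_lhs => rw [hcoeff β hβ]
    exact hrepr _ i
  have hmax : ∀ β ∈ Φ, ∑ i, b.repr β i ≤ ∑ i, b.repr htilde i := by
    intro β hβ
    rw [hheight β hβ, hheight _ hht]
    by_cases h : β = htilde
    · rw [h]
    · exact (hhighest β hβ h).le
  have hpos := repr_highest_pos b hΦrs hbΦ hsign hΦirr hht hmax
  have hrange : Set.range b = ↑Δ := by
    rw [funext hbv]
    exact Subtype.range_coe
  have hmaps : Set.MapsTo ω (↑Δ ∪ {-htilde}) (↑Δ ∪ {-htilde}) :=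
    Set.mapsTo_iff_image_subset.2 hωΔ₀.le
  have hfin : IsOfFinOrder ω := isOfFinOrder_of_mapsTo
    (Δ.finite_toSet.union (Set.finite_singleton _))
    (top_le_iff.1 (hspan.ge.trans (Submodule.span_mono Set.subset_union_left))) hmaps
  obtain ⟨α₁, hα₁, havg⟩ := h0
  have hall : ∀ β ∈ (↑Δ ∪ {-htilde} : Set E), β ∈ orbitOf ω α₁ := by
    intro β hβ
    by_contra hβo
    obtain ⟨f, hf⟩ := exists_functional_pos b hpos (hrange ▸ hβ)
    refine avg_ne_zero_of_pos hfin f (fun γ hγ => hf γ ?_ ?_) havg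
    · rw [hrange]
      exact orbitOf_subset hfin hmaps hα₁ hγ
    · rintro rfl
      exact hβo hγ
  exact fun α hα β hβ => mem_orbitOf_of_mem (hall α hα) (hall β hβ)
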